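/- Assume Condition (C2). Then there are positive finite constants β₁ < β₂ such that for any 0 < ε < β₁ there exists K₁ > 0 so that for all y > x > K₁, one has (x/y)^{β₂+ε} ≤ φ(x)/φ(y) ≤ (x/y)^{β₁−ε}. -/

import Mathlib

open MeasureTheory Filter Set Topology

/-- The tail function of the Lévy measure ν(dx) = dx/θ(x):
    π(x) = 2∫_{1/x}^∞ dz/θ(z). -/
noncomputable def piF (θ : ℝ → ℝ) (x : ℝ) : ℝ :=
  2 * ∫ z in Set.Ioi (1 / x), 1 / θ z

/-- The characteristic exponent ψ(λ) = ∫₀^∞ (1 − cos(xλ)) dx/θ(x). -/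
noncomputable def psiF (θ : ℝ → ℝ) (l : ℝ) : ℝ :=
  ∫ x in Set.Ioi (0 : ℝ), (1 - Real.cos (x * l)) / θ x

/-- φ(x) = 2∫_{1/x}^∞ dλ/ψ(λ). -/
noncomputable def phiF (θ : ℝ → ℝ) (x : ℝ) : ℝ :=
  2 * ∫ l in Set.Ioi (1 / x), 1 / psiF θ l

/-- σ₀²(x) = (2/π)∫₀^∞ (1 − cos(λx)) dλ/ψ(λ). -/
noncomputable def sigma0sq (θ : ℝ → ℝ) (x : ℝ) : ℝ :=
  (2 / Real.pi) * ∫ l in Set.Ioi (0 : ℝ), (1 - Real.cos (l * x)) / psiF θ l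

/-- σ̂₀²(h) = sup_{|x| ≤ h} σ₀²(x). -/
noncomputable def sigma0sqHat (θ : ℝ → ℝ) (h : ℝ) : ℝ :=
  sSup (sigma0sq θ '' {x : ℝ | |x| ≤ h})

/-- H(x) = ∫₀^∞ min(1, (λ/x)²) dλ/ψ(λ). -/
noncomputable def Hfun (θ : ℝ → ℝ) (x : ℝ) : ℝ :=
  ∫ l in Set.Ioi (0 : ℝ), min 1 ((l / x) ^ 2) / psiF θ l

/-- Standing assumptions on θ: measurability, positivity on (0,∞), and
    ∫₀^∞ min(1, x²)/θ(x) dx < ∞, so that ν(dx) = dx/θ(x) is the Lévy measure of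
    a symmetric pure-jump Lévy process. -/
def ThetaOK (θ : ℝ → ℝ) : Prop :=
  Measurable θ ∧ (∀ x ∈ Set.Ioi (0 : ℝ), 0 < θ x) ∧
    MeasureTheory.IntegrableOn (fun x => min 1 (x ^ 2) / θ x) (Set.Ioi 0)

/-- Existence of local times: ∫₁^∞ dλ/ψ(λ) < ∞. -/
def PsiIntegrable (θ : ℝ → ℝ) : Prop :=
  MeasureTheory.IntegrableOn (fun l => 1 / psiF θ l) (Set.Ioi 1)

/-- Condition (C1): 1 < α̲ ≤ ᾱ < 2, where α̲ and ᾱ are the liminf and the limsup, as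
    x → 0⁺, of (x/θ(x))/ν({z : |z| ≥ x}) = (x/θ(x))/π(1/x) (which is in particular
    eventually bounded above since the limsup is finite). -/
def CondC1 (θ : ℝ → ℝ) (al ah : ℝ) : Prop :=
  1 < al ∧ al ≤ ah ∧ ah < 2 ∧
  Filter.IsBoundedUnder (· ≤ ·) (𝓝[>] (0 : ℝ))
    (fun x => (x / θ x) / piF θ (1 / x)) ∧
  Filter.liminf (fun x => (x / θ x) / piF θ (1 / x)) (𝓝[>] (0 : ℝ)) = al ∧
  Filter.limsup (fun x => (x / θ x) / piF θ (1 / x)) (𝓝[>] (0 : ℝ)) = ah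

/-- Condition (C2): 1 < β̲ ≤ β̄ < 2, where β̲ and β̄ are the liminf and the limsup, as
    x → ∞, of (x/θ(x))/ν({z : |z| ≥ x}) = (x/θ(x))/π(1/x). -/
def CondC2 (θ : ℝ → ℝ) (bl bh : ℝ) : Prop :=
  1 < bl ∧ bl ≤ bh ∧ bh < 2 ∧
  Filter.IsBoundedUnder (· ≤ ·) Filter.atTop
    (fun x => (x / θ x) / piF θ (1 / x)) ∧
  Filter.liminf (fun x => (x / θ x) / piF θ (1 / x)) Filter.atTop = bl ∧
  Filter.limsup (fun x => (x / θ x) / piF θ (1 / x)) Filter.atTop = bh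


lemma aux_moment_R (g : ℝ → ℝ) (hg : Measurable g) (K b : ℝ) (hK : 1 ≤ K) (hb : 1 < b)
    (hg0 : ∀ x, K ≤ x → 0 ≤ g x) (hgi : IntegrableOn g (Ioi K))
    (h : ∀ x, K ≤ x → 2 * b * ∫ z in Ioi x, g z ≤ x * g x) (R : ℝ) :
    ∫⁻ z in Ioc K R, ENNReal.ofReal (z ^ 2 * g z) ≤
      ENNReal.ofReal (K ^ 2 * (∫ z in Ioi K, g z) / (1 - 1 / b)) := by
  have hG : ∀ x, K ≤ x → ∫⁻ z in Ioi x, ENNReal.ofReal (g z)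
      = ENNReal.ofReal (∫ z in Ioi x, g z) := by
    intro x hx
    rw [ofReal_integral_eq_lintegral_ofReal (hgi.mono_set (Ioi_subset_Ioi hx))]
    filter_upwards [ae_restrict_mem measurableSet_Ioi] with z hz
    exact hg0 z (hx.trans (le_of_lt hz))
  have hGn : ∀ x, K ≤ x → 0 ≤ ∫ z in Ioi x, g z := by
    intro x hx
    exact setIntegral_nonneg measurableSet_Ioi fun z hz => hg0 z (hx.trans (le_of_lt hz))
  set I := ∫⁻ z in Ioc K R, ENNReal.ofReal (z ^ 2 * g z) with hI
  have hIfin : I ≠ ⊤ := by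
    have : I ≤ ENNReal.ofReal (R ^ 2) * ∫⁻ z in Ioi K, ENNReal.ofReal (g z) := by
      rw [← lintegral_const_mul _ (by fun_prop)]
      refine (setLIntegral_mono (by fun_prop) ?_).trans
        (lintegral_mono_set Ioc_subset_Ioi_self)
      intro z hz
      rw [← ENNReal.ofReal_mul (by positivity)]
      apply ENNReal.ofReal_le_ofReal
      have := hg0 z hz.1.le
      have h0 : 0 ≤ z := by linarith [hz.1]
      have := hz.2
      gcongr
    refine ne_top_of_le_ne_top ?_ this
    rw [hG K le_rfl]
    exact ENNReal.mul_ne_top ENNReal.ofReal_ne_top ENNReal.ofReal_ne_top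
  have hsq : ∀ z ∈ Ioc K R, ENNReal.ofReal (z ^ 2) = ENNReal.ofReal (K ^ 2) +
      ∫⁻ x in Ioc K R, (Iio z).indicator (fun x => ENNReal.ofReal (2 * x)) x := by
    intro z hz
    rw [lintegral_indicator measurableSet_Iio, Measure.restrict_restrict measurableSet_Iio]
    have hset : Iio z ∩ Ioc K R = Ioo K z := by
      ext x; simp only [mem_inter_iff, mem_Iio, mem_Ioc, mem_Ioo]
      constructor
      · rintro ⟨h1, h2, h3⟩; exact ⟨h2, h1⟩
      · rintro ⟨h1, h2⟩; exact ⟨h2, h1, h2.le.trans hz.2⟩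
    rw [hset, restrict_Ioo_eq_restrict_Ioc, ← ofReal_integral_eq_lintegral_ofReal,
      ← intervalIntegral.integral_of_le hz.1.le, intervalIntegral.integral_const_mul,
      integral_id, ← ENNReal.ofReal_add (by positivity)]
    · congr 1; ring
    · have := hz.1
      nlinarith
    · exact (by fun_prop : Continuous fun x : ℝ => 2 * x).integrableOn_Ioc
    · filter_upwards [ae_restrict_mem measurableSet_Ioc] with x hx
      have := hx.1
      simp only [Pi.zero_apply]; linarith
  have key : I ≤ ENNReal.ofReal (K ^ 2 * ∫ z in Ioi K, g z) + ENNReal.ofReal (1 / b) * I := by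
    calc I = ∫⁻ z in Ioc K R, (ENNReal.ofReal (K ^ 2) * ENNReal.ofReal (g z) +
          ∫⁻ x in Ioc K R, (Iio z).indicator (fun x => ENNReal.ofReal (2 * x)) x
            * ENNReal.ofReal (g z)) := by
          apply setLIntegral_congr_fun measurableSet_Ioc
          intro z hz
          simp only
          rw [lintegral_mul_const _ (Measurable.indicator (by fun_prop) measurableSet_Iio),
            ← add_mul, ← hsq z hz, ENNReal.ofReal_mul (by positivity)]
      _ = ENNReal.ofReal (K ^ 2) * (∫⁻ z in Ioc K R, ENNReal.ofReal (g z)) +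
          ∫⁻ z in Ioc K R, ∫⁻ x in Ioc K R,
            (Iio z).indicator (fun x => ENNReal.ofReal (2 * x)) x
            * ENNReal.ofReal (g z) := by
          rw [lintegral_add_left (by fun_prop), lintegral_const_mul _ (by fun_prop)]
      _ = ENNReal.ofReal (K ^ 2) * (∫⁻ z in Ioc K R, ENNReal.ofReal (g z)) +
          ∫⁻ x in Ioc K R, ∫⁻ z in Ioc K R,
            (Iio z).indicator (fun x => ENNReal.ofReal (2 * x)) x
            * ENNReal.ofReal (g z) := by
          congr 1
          apply lintegral_lintegral_swap
          apply Measurable.aemeasurable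
          apply Measurable.mul
          · have : (fun p : ℝ × ℝ => (Iio p.1).indicator (fun x => ENNReal.ofReal (2 * x)) p.2)
              = {p : ℝ × ℝ | p.2 < p.1}.indicator (fun p => ENNReal.ofReal (2 * p.2)) := by
              ext p; simp [indicator]
            change Measurable (fun p : ℝ × ℝ =>
              (Iio p.1).indicator (fun x => ENNReal.ofReal (2 * x)) p.2)
            rw [this]
            exact Measurable.indicator (by fun_prop)
              (measurableSet_lt measurable_snd measurable_fst)
          · exact (hg.comp measurable_fst).ennreal_ofReal
      _ ≤ ENNReal.ofReal (K ^ 2 * ∫ z in Ioi K, g z) + ENNReal.ofReal (1 / b) * I := by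
          apply add_le_add
          · rw [ENNReal.ofReal_mul (by positivity), ← hG K le_rfl]
            gcongr
            exact Ioc_subset_Ioi_self
          · rw [hI, ← lintegral_const_mul _ (by fun_prop)]
            apply setLIntegral_mono (by fun_prop)
            intro x hx
            have hx0 : 0 < x := by linarith [hx.1]
            calc ∫⁻ z in Ioc K R, (Iio z).indicator (fun x => ENNReal.ofReal (2 * x)) x
                  * ENNReal.ofReal (g z)
                = ∫⁻ z in Ioc K R, (Ioi x).indicator
                  (fun z => ENNReal.ofReal (2 * x) * ENNReal.ofReal (g z)) z := by
                  congr 1; ext z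
                  by_cases hz : x < z <;> simp [indicator, hz]
              _ ≤ ∫⁻ z in Ioi x, ENNReal.ofReal (2 * x) * ENNReal.ofReal (g z) := by
                  rw [lintegral_indicator measurableSet_Ioi,
                    Measure.restrict_restrict measurableSet_Ioi]
                  exact lintegral_mono_set inter_subset_left
              _ = ENNReal.ofReal (2 * x * ∫ z in Ioi x, g z) := by
                  rw [lintegral_const_mul _ (by fun_prop), hG x hx.1.le,
                    ← ENNReal.ofReal_mul (by positivity)]
              _ ≤ _ := by
                  rw [← ENNReal.ofReal_mul (by positivity)]
                  apply ENNReal.ofReal_le_ofReal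
                  have := h x hx.1.le
                  rw [one_div, ← div_eq_inv_mul, le_div_iff₀ (by linarith)]
                  nlinarith
  have hb1 : 0 < 1 - 1 / b := by
    have : 1 / b < 1 := by rw [div_lt_one (by linarith)]; exact hb
    linarith
  have hb2 : 0 < 1 / b := by positivity
  have hGK := hGn K le_rfl
  rw [← ENNReal.ofReal_toReal hIfin] at key ⊢
  rw [← ENNReal.ofReal_mul (by positivity), ← ENNReal.ofReal_add (by positivity)
    (by positivity), ENNReal.ofReal_le_ofReal_iff (by positivity)] at key
  apply ENNReal.ofReal_le_ofReal
  rw [le_div_iff₀ hb1]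
  linarith

lemma aux_moment (g : ℝ → ℝ) (hg : Measurable g) (K b : ℝ) (hK : 1 ≤ K) (hb : 1 < b)
    (hg0 : ∀ x, K ≤ x → 0 ≤ g x) (hgi : IntegrableOn g (Ioi K))
    (h : ∀ x, K ≤ x → 2 * b * ∫ z in Ioi x, g z ≤ x * g x) :
    IntegrableOn (fun z => z ^ 2 * g z) (Ioi K) := by
  refine ⟨by fun_prop, ?_⟩
  rw [hasFiniteIntegral_iff_ofReal]
  swap
  · filter_upwards [ae_restrict_mem measurableSet_Ioi] with z hz
    have := hg0 z (le_of_lt hz)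
    simp only [Pi.zero_apply]; positivity
  have hU : (Ioi K) = ⋃ n : ℕ, Ioc K (n : ℝ) := by
    ext z
    simp only [mem_Ioi, mem_iUnion, mem_Ioc]
    constructor
    · intro hz
      obtain ⟨n, hn⟩ := exists_nat_ge z
      exact ⟨n, hz, hn⟩
    · rintro ⟨n, h1, h2⟩; exact h1
  have hmono : Monotone fun n : ℕ => Ioc K (n : ℝ) := by
    intro m n hmn
    exact Ioc_subset_Ioc_right (by exact_mod_cast hmn)
  rw [hU, setLIntegral_iUnion_of_directed _ (directed_of_isDirected_le hmono)]
  refine lt_of_le_of_lt (iSup_le fun n => aux_moment_R g hg K b hK hb hg0 hgi h n)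
    ENNReal.ofReal_lt_top

lemma aux_second_moment (θ : ℝ → ℝ) (bl bh : ℝ)
    (hθ : ThetaOK θ) (hC2 : CondC2 θ bl bh) :
    IntegrableOn (fun z => z ^ 2 / θ z) (Ioi 0) := by
  obtain ⟨hm, hpos, hint⟩ := hθ
  obtain ⟨h1, -, -, -, hlim, -⟩ := hC2
  have hpi : ∀ x : ℝ, 0 < x → 0 ≤ piF θ (1 / x) := by
    intro x hx
    unfold piF
    simp only [one_div, inv_inv]
    refine mul_nonneg (by norm_num) (setIntegral_nonneg measurableSet_Ioi fun z hz => ?_)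
    exact inv_nonneg.2 (hpos z (hx.trans hz)).le
  have hbdd : IsBoundedUnder (· ≥ ·) atTop (fun x => (x / θ x) / piF θ (1 / x)) := by
    refine ⟨0, ?_⟩
    rw [eventually_map]
    filter_upwards [eventually_gt_atTop 0] with x hx
    exact div_nonneg (div_nonneg hx.le (hpos x hx).le) (hpi x hx)
  have hb : (1 + bl) / 2 < liminf (fun x => (x / θ x) / piF θ (1 / x)) atTop := by
    rw [hlim]; linarith
  have hev := eventually_lt_of_lt_liminf hb hbdd
  obtain ⟨K₀, hK₀⟩ := eventually_atTop.1 hev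
  set K := max K₀ 1 with hK
  have hK1 : 1 ≤ K := le_max_right _ _
  set b := (1 + bl) / 2 with hbdef
  have hb1 : 1 < b := by rw [hbdef]; linarith
  have hmin1 : ∀ z : ℝ, 1 ≤ z → min 1 (z ^ 2) = 1 := fun z hz =>
    min_eq_left (by nlinarith)
  have hgi : IntegrableOn (fun z => 1 / θ z) (Ioi 1) := by
    refine (hint.mono_set (Ioi_subset_Ioi zero_le_one)).congr_fun ?_ measurableSet_Ioi
    intro z hz
    simp only [hmin1 z (le_of_lt hz)]
  have hA : IntegrableOn (fun z => z ^ 2 / θ z) (Ioi K) := by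
    have := aux_moment (fun z => 1 / θ z) (by fun_prop) K b hK1 hb1
      (fun x hx => one_div_nonneg.2 (hpos x (mem_Ioi.2 (by linarith))).le)
      (hgi.mono_set (Ioi_subset_Ioi hK1)) ?_
    · refine this.congr_fun ?_ measurableSet_Ioi
      intro z hz
      simp only; ring
    · intro x hx
      have hx0 : 0 < x := by linarith
      have hr := hK₀ x ((le_max_left _ _).trans hx)
      have hp : 0 < piF θ (1 / x) := by
        rcases (hpi x hx0).lt_or_eq with h | h
        · exact h
        · rw [← h, div_zero] at hr; linarith
      rw [lt_div_iff₀ hp] at hr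
      unfold piF at hr
      simp only [one_div, inv_inv] at hr ⊢
      rw [div_eq_mul_inv] at hr
      linarith
  have hB : IntegrableOn (fun z => z ^ 2 / θ z) (Ioc 0 K) := by
    have hi := (hint.mono_set (Ioc_subset_Ioi_self : Ioc 0 K ⊆ Ioi 0)).const_mul (K ^ 2)
    refine hi.mono' (by apply Measurable.aestronglyMeasurable; fun_prop) ?_
    filter_upwards [ae_restrict_mem measurableSet_Ioc] with z hz
    have ht := hpos z hz.1
    rw [Real.norm_of_nonneg (by positivity), ← mul_div_assoc]
    apply div_le_div_of_nonneg_right _ ht.le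
    rcases le_total 1 z with h | h
    · rw [hmin1 z h, mul_one]
      have := hz.2; have := hz.1
      gcongr
    · rw [min_eq_right (by nlinarith [hz.1])]
      nlinarith [sq_nonneg z, sq_nonneg (K - 1)]
  rw [← Ioc_union_Ioi_eq_Ioi (by linarith : (0 : ℝ) ≤ K)]
  exact hB.union hA

lemma aux_psi_meas (θ : ℝ → ℝ) (hm : Measurable θ) : Measurable (psiF θ) := by
  unfold psiF
  apply StronglyMeasurable.measurable
  apply StronglyMeasurable.integral_prod_right' (f := fun p : ℝ × ℝ =>
    (1 - Real.cos (p.2 * p.1)) / θ p.2)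
  apply Measurable.stronglyMeasurable
  fun_prop

lemma aux_psi_bounds (θ : ℝ → ℝ) (hθ : ThetaOK θ)
    (h2 : IntegrableOn (fun z => z ^ 2 / θ z) (Ioi 0)) :
    ∃ c C : ℝ, 0 < c ∧ 0 < C ∧ (∀ s, 0 < s → s ≤ 1 → c * s ^ 2 ≤ psiF θ s) ∧
      (∀ s, psiF θ s ≤ C * s ^ 2) ∧ ∀ s, 0 ≤ psiF θ s := by
  obtain ⟨hm, hpos, hint⟩ := hθ
  have hle : ∀ s x, 1 - Real.cos (x * s) ≤ x ^ 2 * s ^ 2 / 2 := by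
    intro s x
    have := Real.one_sub_sq_div_two_le_cos (x := x * s)
    nlinarith
  have hi : ∀ s, IntegrableOn (fun x => (1 - Real.cos (x * s)) / θ x) (Ioi 0) := by
    intro s
    refine (h2.const_mul (s ^ 2 / 2)).mono'
      (by apply Measurable.aestronglyMeasurable; fun_prop) ?_
    filter_upwards [ae_restrict_mem measurableSet_Ioi] with z hz
    have ht := hpos z hz
    rw [Real.norm_of_nonneg (div_nonneg (by linarith [Real.cos_le_one (z * s)]) ht.le),
      ← mul_div_assoc]
    apply div_le_div_of_nonneg_right _ ht.le
    linarith [hle s z]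
  have hp1 : 0 < ∫ x in Ioc (0 : ℝ) 1, x ^ 2 / θ x := by
    rw [setIntegral_pos_iff_support_of_nonneg_ae]
    · have : Function.support (fun x => x ^ 2 / θ x) ∩ Ioc 0 1 = Ioc 0 1 := by
        apply inter_eq_right.2
        intro x hx
        have := hpos x hx.1
        have := hx.1
        simp only [Function.mem_support]
        positivity
      rw [this]; simp
    · filter_upwards [ae_restrict_mem measurableSet_Ioc] with z hz
      have := hpos z hz.1
      simp only [Pi.zero_apply]; positivity
    · exact h2.mono_set Ioc_subset_Ioi_self
  have hp2 : ∫ x in Ioc (0 : ℝ) 1, x ^ 2 / θ x ≤ ∫ x in Ioi (0 : ℝ), x ^ 2 / θ x := by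
    apply setIntegral_mono_set h2 _ (Ioc_subset_Ioi_self).eventuallyLE
    filter_upwards [ae_restrict_mem measurableSet_Ioi] with z hz
    have := hpos z hz
    simp only [Pi.zero_apply]; positivity
  refine ⟨2 / Real.pi ^ 2 * ∫ x in Ioc (0 : ℝ) 1, x ^ 2 / θ x,
    1 / 2 * ∫ x in Ioi (0 : ℝ), x ^ 2 / θ x, by positivity, by linarith, ?_, ?_, ?_⟩
  · intro s hs0 hs1
    have e : 2 / Real.pi ^ 2 * (∫ x in Ioc (0 : ℝ) 1, x ^ 2 / θ x) * s ^ 2 =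
      ∫ x in Ioc (0 : ℝ) 1, (2 / Real.pi ^ 2 * s ^ 2) * (x ^ 2 / θ x) := by
      rw [integral_const_mul]; ring
    rw [e]
    have h3 : ∫ x in Ioc (0 : ℝ) 1, (2 / Real.pi ^ 2 * s ^ 2) * (x ^ 2 / θ x) ≤
        ∫ x in Ioc (0 : ℝ) 1, (1 - Real.cos (x * s)) / θ x := by
      apply setIntegral_mono_on ((h2.mono_set Ioc_subset_Ioi_self).const_mul _)
        ((hi s).mono_set Ioc_subset_Ioi_self) measurableSet_Ioc
      intro x hx
      have ht := hpos x hx.1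
      rw [← mul_div_assoc]
      apply div_le_div_of_nonneg_right _ ht.le
      have : |x * s| ≤ Real.pi := by
        rw [abs_of_pos (mul_pos hx.1 hs0)]
        have := mul_le_mul hx.2 hs1 hs0.le zero_le_one
        linarith [Real.pi_gt_three]
      have := Real.cos_le_one_sub_mul_cos_sq ‹|x * s| ≤ Real.pi›
      rw [mul_pow] at this
      linarith
    refine h3.trans ?_
    apply setIntegral_mono_set (hi s) _ (Ioc_subset_Ioi_self).eventuallyLE
    filter_upwards [ae_restrict_mem measurableSet_Ioi] with z hz
    exact div_nonneg (by linarith [Real.cos_le_one (z * s)]) (hpos z hz).le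
  · intro s
    have e : 1 / 2 * (∫ x in Ioi (0 : ℝ), x ^ 2 / θ x) * s ^ 2 =
      ∫ x in Ioi (0 : ℝ), (s ^ 2 / 2) * (x ^ 2 / θ x) := by
      rw [integral_const_mul]; ring
    rw [e]
    apply setIntegral_mono_on (hi s) (h2.const_mul _) measurableSet_Ioi
    intro x hx
    have ht := hpos x hx
    rw [← mul_div_assoc]
    apply div_le_div_of_nonneg_right _ ht.le
    linarith [hle s x]
  · intro s
    apply setIntegral_nonneg measurableSet_Ioi
    intro z hz
    exact div_nonneg (by linarith [Real.cos_le_one (z * s)]) (hpos z hz).le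

lemma aux_int_sq (a l m : ℝ) (hl : 0 < l) (hlm : l ≤ m) :
    IntegrableOn (fun s : ℝ => a * (s ^ 2)⁻¹) (Ioc l m) ∧
    ∫ s in Ioc l m, a * (s ^ 2)⁻¹ = a * (1 / l - 1 / m) := by
  have hne : ∀ x ∈ uIcc l m, x ≠ 0 := by
    intro x hx
    rw [uIcc_of_le hlm] at hx
    linarith [hx.1]
  have hc : ContinuousOn (fun s : ℝ => a * (s ^ 2)⁻¹) (uIcc l m) := by
    apply ContinuousOn.mul continuousOn_const
    exact ContinuousOn.inv₀ (by fun_prop) (fun x hx => pow_ne_zero 2 (hne x hx))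
  have hI := hc.intervalIntegrable (μ := volume)
  refine ⟨(intervalIntegrable_iff_integrableOn_Ioc_of_le hlm).1 hI, ?_⟩
  rw [← intervalIntegral.integral_of_le hlm,
    intervalIntegral.integral_eq_sub_of_hasDerivAt (f := fun s => -a * s⁻¹) _ hI]
  · simp only [one_div]; ring
  · intro x hx
    have := (hasDerivAt_inv (hne x hx)).const_mul (-a)
    exact this.congr_deriv (by ring)

/-- Lemma 2.6, Eq. (2.10): under (C2), there are positive finite constants β₁ < β₂ such that
    for any 0 < ε < β₁ there exists K₁ > 0 so that for all y > x > K₁,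
    (x/y)^{β₂+ε} ≤ φ(x)/φ(y) ≤ (x/y)^{β₁−ε}. -/
theorem ratio_control_phi_at_infty (θ : ℝ → ℝ) (bl bh : ℝ)
    (hθ : ThetaOK θ) (hψ : PsiIntegrable θ) (hC2 : CondC2 θ bl bh) :
    ∃ β₁ β₂ : ℝ, 0 < β₁ ∧ β₁ < β₂ ∧
      ∀ ε : ℝ, 0 < ε → ε < β₁ →
        ∃ K₁ : ℝ, 0 < K₁ ∧ ∀ x y : ℝ, K₁ < x → x < y →
          (x / y) ^ (β₂ + ε) ≤ phiF θ x / phiF θ y ∧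
          phiF θ x / phiF θ y ≤ (x / y) ^ (β₁ - ε) := by
  have h2 := aux_second_moment θ bl bh hθ hC2
  obtain ⟨c, C, hc, hC, hlow, hup, hnn⟩ := aux_psi_bounds θ hθ h2
  have hmeas := aux_psi_meas θ hθ.1
  have hupper : ∀ s, 0 < s → s ≤ 1 → 1 / psiF θ s ≤ (1 / c) * (s ^ 2)⁻¹ := by
    intro s h0 h1
    rw [one_div, one_div, ← mul_inv]
    exact inv_anti₀ (by positivity) (hlow s h0 h1)
  have hlower : ∀ s, 0 < s → s ≤ 1 → (1 / C) * (s ^ 2)⁻¹ ≤ 1 / psiF θ s := by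
    intro s h0 h1
    rw [one_div, one_div, ← mul_inv]
    exact inv_anti₀ (lt_of_lt_of_le (by positivity) (hlow s h0 h1)) (hup s)
  have hIoc : ∀ l m, 0 < l → m ≤ 1 → IntegrableOn (fun s => 1 / psiF θ s) (Ioc l m) := by
    intro l m hl hm
    rcases le_total l m with hlm | hlm
    · refine (aux_int_sq (1 / c) l m hl hlm).1.mono'
        (by apply Measurable.aestronglyMeasurable; fun_prop) ?_
      filter_upwards [ae_restrict_mem measurableSet_Ioc] with s hs
      rw [Real.norm_of_nonneg (one_div_nonneg.2 (hnn s))]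
      exact hupper s (hl.trans hs.1) (hs.2.trans hm)
    · rw [Ioc_eq_empty (by simpa using hlm)]; exact integrableOn_empty
  have hIoi : ∀ l, 0 < l → l ≤ 1 → IntegrableOn (fun s => 1 / psiF θ s) (Ioi l) := by
    intro l hl hl1
    rw [← Ioc_union_Ioi_eq_Ioi hl1]
    exact (hIoc l 1 hl le_rfl).union hψ
  have hsplit : ∀ l m, 0 < l → l ≤ m → m ≤ 1 → ∫ s in Ioi l, 1 / psiF θ s =
      (∫ s in Ioc l m, 1 / psiF θ s) + ∫ s in Ioi m, 1 / psiF θ s := by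
    intro l m hl hlm hm
    rw [← Ioc_union_Ioi_eq_Ioi hlm, setIntegral_union (Ioc_disjoint_Ioi le_rfl)
      measurableSet_Ioi (hIoc l m hl hm) (hIoi m (hl.trans_le hlm) hm)]
  have hiu : ∀ l m, 0 < l → l ≤ m → m ≤ 1 →
      ∫ s in Ioc l m, 1 / psiF θ s ≤ (1 / c) * (1 / l - 1 / m) := by
    intro l m hl hlm hm
    rw [← (aux_int_sq (1 / c) l m hl hlm).2]
    exact setIntegral_mono_on (hIoc l m hl hm) (aux_int_sq (1 / c) l m hl hlm).1
      measurableSet_Ioc fun s hs => hupper s (hl.trans hs.1) (hs.2.trans hm)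
  have hil : ∀ l m, 0 < l → l ≤ m → m ≤ 1 →
      (1 / C) * (1 / l - 1 / m) ≤ ∫ s in Ioc l m, 1 / psiF θ s := by
    intro l m hl hlm hm
    rw [← (aux_int_sq (1 / C) l m hl hlm).2]
    exact setIntegral_mono_on (aux_int_sq (1 / C) l m hl hlm).1 (hIoc l m hl hm)
      measurableSet_Ioc fun s hs => hlower s (hl.trans hs.1) (hs.2.trans hm)
  have hFn : ∀ m, 0 ≤ ∫ s in Ioi m, 1 / psiF θ s := fun m =>
    setIntegral_nonneg measurableSet_Ioi fun s _ => one_div_nonneg.2 (hnn s)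
  set F1 := ∫ s in Ioi 1, 1 / psiF θ s with hF1
  have hF1n : 0 ≤ F1 := hFn 1
  set D := 1 / c + F1 with hD
  have hDpos : 0 < D := by positivity
  -- A and B
  set A := min (1 / 2) (1 / C / D) with hA
  set B := max 1 (2 * C / c) with hB
  have hApos : 0 < A := lt_min (by norm_num) (by positivity)
  have hA1 : A ≤ 1 / 2 := min_le_left _ _
  have hA2 : A * D ≤ 1 / C := by
    rw [← le_div_iff₀ hDpos]; exact min_le_right _ _
  have hB1 : 1 ≤ B := le_max_left _ _
  have hB2 : 1 / c ≤ B * (1 / (2 * C)) := by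
    have : 2 * C / c ≤ B := le_max_right _ _
    rw [mul_one_div, le_div_iff₀ (by positivity)]
    calc 1 / c * (2 * C) = 2 * C / c := by ring
      _ ≤ B := this
  refine ⟨A, B, hApos, by linarith, ?_⟩
  intro ε hε hεA
  refine ⟨2, by norm_num, ?_⟩
  intro x y hx hxy
  have hx0 : 0 < x := by linarith
  have hy0 : 0 < y := by linarith
  set P := ∫ s in Ioi (1 / x), 1 / psiF θ s with hP
  set Q := ∫ s in Ioi (1 / y), 1 / psiF θ s with hQ
  set J := ∫ s in Ioc (1 / y) (1 / x), 1 / psiF θ s with hJ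
  have hx1 : 1 / x ≤ 1 / 2 := one_div_le_one_div_of_le (by norm_num) hx.le
  have hyx : 1 / y ≤ 1 / x := one_div_le_one_div_of_le hx0 hxy.le
  have hQP : Q = J + P := hsplit _ _ (by positivity) hyx (by linarith)
  have hJu : J ≤ 1 / c * (y - x) := by
    have := hiu (1 / y) (1 / x) (by positivity) hyx (by linarith)
    simpa only [one_div_one_div] using this
  have hJl : 1 / C * (y - x) ≤ J := by
    have := hil (1 / y) (1 / x) (by positivity) hyx (by linarith)
    simpa only [one_div_one_div] using this
  have hPs : P = (∫ s in Ioc (1 / x) 1, 1 / psiF θ s) + F1 :=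
    hsplit _ _ (by positivity) (by linarith) le_rfl
  have hPu : P ≤ D * x := by
    have := hiu (1 / x) 1 (by positivity) (by linarith) le_rfl
    simp only [one_div_one_div] at this
    have : 0 < 1 / c := by positivity
    rw [hPs, hD]
    nlinarith
  have hPl : 1 / (2 * C) * x ≤ P := by
    have := hil (1 / x) 1 (by positivity) (by linarith) le_rfl
    simp only [one_div_one_div, one_div_one] at this
    have h3 : 1 / (2 * C) * x = 1 / C * (x / 2) := by field_simp
    have h4 : 1 / C * (x / 2) ≤ 1 / C * (x - 1) := by
      apply mul_le_mul_of_nonneg_left (by linarith) (by positivity)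
    rw [hPs, h3]
    linarith
  have hPpos : 0 < P := lt_of_lt_of_le (by positivity) hPl
  have hφ : phiF θ x / phiF θ y = (Q / P)⁻¹ := by
    unfold phiF
    rw [inv_div, mul_div_mul_left _ _ (by norm_num)]
  set t := y / x with ht
  have ht1 : 1 < t := by rw [ht, one_lt_div hx0]; exact hxy
  have hxt : x / y = t⁻¹ := by rw [ht, inv_div]
  have hyt : y - x = x * (t - 1) := by rw [ht]; field_simp
  have hQu : Q / P ≤ t ^ B := by
    have hbern := one_add_mul_self_le_rpow_one_add (s := t - 1) (by linarith) hB1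
    rw [add_sub_cancel] at hbern
    refine le_trans ?_ hbern
    rw [div_le_iff₀ hPpos, hQP]
    have : J ≤ B * (t - 1) * P := by
      calc J ≤ 1 / c * (y - x) := hJu
        _ ≤ B * (1 / (2 * C)) * (y - x) := by
            apply mul_le_mul_of_nonneg_right hB2 (by linarith)
        _ = B * (t - 1) * (1 / (2 * C) * x) := by rw [hyt]; ring
        _ ≤ B * (t - 1) * P := by
            apply mul_le_mul_of_nonneg_left hPl
            apply mul_nonneg <;> linarith
    linarith
  have hQl : t ^ A ≤ Q / P := by
    have hbern := rpow_one_add_le_one_add_mul_self (s := t - 1) (by linarith) hApos.le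
      (by linarith)
    rw [add_sub_cancel] at hbern
    refine le_trans hbern ?_
    rw [le_div_iff₀ hPpos, hQP]
    have : A * (t - 1) * P ≤ J := by
      calc A * (t - 1) * P ≤ A * (t - 1) * (D * x) := by
            apply mul_le_mul_of_nonneg_left hPu
            apply mul_nonneg <;> linarith
        _ = A * D * (y - x) := by rw [hyt]; ring
        _ ≤ 1 / C * (y - x) := mul_le_mul_of_nonneg_right hA2 (by linarith)
        _ ≤ J := hJl
    linarith
  have ht0 : 0 < t := by linarith
  have hQPpos : 0 < Q / P := lt_of_lt_of_le (by positivity) hQl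
  rw [hφ, hxt, Real.inv_rpow ht0.le, Real.inv_rpow ht0.le]
  constructor
  · apply inv_anti₀ hQPpos
    exact hQu.trans (Real.rpow_le_rpow_of_exponent_le ht1.le (by linarith))
  · apply inv_anti₀ (by positivity)
    exact le_trans (Real.rpow_le_rpow_of_exponent_le ht1.le (by linarith)) hQl
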